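/- (Multi-parameter oracle adjustment.) Let m be a positive integer, θ ∈ ℝ^m, and let (θ̂_n) be a sequence of ℝ^m-valued random vectors satisfying: (B1) ‖E[θ̂_n − θ]‖_∞ = o(n⁻¹); (B2) the covariance matrices Σ_n = E[(θ̂_n − θ)(θ̂_n − θ)ᵀ] satisfy lim_{n→∞} n·Σ_n = Σ for some matrix Σ ∈ ℝ^{m×m}; (B3) for every integer k ≥ 3, the maximal absolute entry of the k-fold tensor E[(θ̂_n − θ)^{⊗k}] is O(n^{−k/2}). Let R : ℝ^m → ℝ be five times continuously differentiable with: (C1) ∇R(θ) = 0; (C2) there exists a matrix M ∈ ℝ^{m×m} such that for every diagonal matrix Λ ∈ ℝ^{m×m}, ⟨H, ΛM⟩ = Σ_{i,j,k} (∇³R(θ))_{ijk}·(Λθ)_i·Σ_{jk}, where H = ∇²R(θ) and ⟨·,·⟩ is the Frobenius inner product; (C3) the maximal absolute entry of ∇⁵R(x) is uniformly bounded over x ∈ ℝ^m. Then for every diagonal matrix Λ = diag(λ) with λ ∈ ℝ^m, lim_{n→∞} n²·( E[R((I + Λ/n)·θ̂_n)] − E[R(θ̂_n)] ) = (1/2)·(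 λᵀ A λ + bᵀ λ ), where A ∈ ℝ^{m×m} has entries A_{ij} = H_{ij}·θ_i·θ_j and b = (H ⊙ (2Σ + M))·𝟙_m, with ⊙ the entrywise (Hadamard) product and 𝟙_m the all-ones vector. Moreover, if A is negative definite, the unique maximizer of λ ↦ (1/2)(λᵀAλ + bᵀλ) is λ* = −(1/2)·A⁻¹·b. -/

import Mathlib

open MeasureTheory Filter Asymptotics Real

/-- Expansion of a multilinear form on the diagonal in coordinates. -/
lemma aux_diag_expand {m k : ℕ} (F : ContinuousMultilinearMap ℝ (fun _ : Fin k => (Fin m → ℝ)) ℝ)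
    (y : Fin m → ℝ) :
    F (fun _ => y) = ∑ idx : Fin k → Fin m,
      (∏ l, y (idx l)) * F (fun l => Pi.single (idx l) 1) := by
  have h : y = ∑ j, y j • (Pi.single j 1 : Fin m → ℝ) := by
    ext i
    simp [Finset.sum_apply, Pi.single_apply]
  conv_lhs => rw [h]
  have := F.toMultilinearMap.map_sum (fun (_ : Fin k) (j : Fin m) => y j • (Pi.single j 1 : Fin m → ℝ))
  simp only [ContinuousMultilinearMap.coe_coe] at this
  rw [this]
  refine Finset.sum_congr rfl fun idx _ => ?_
  have := F.toMultilinearMap.map_smul_univ (fun l => y (idx l)) (fun l => (Pi.single (idx l) 1 : Fin m → ℝ))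
  simpa using this

lemma aux_diag_bound {m k : ℕ} (F : ContinuousMultilinearMap ℝ (fun _ : Fin k => (Fin m → ℝ)) ℝ)
    (K : ℝ) (hK : ∀ idx : Fin k → Fin m, |F (fun l => Pi.single (idx l) 1)| ≤ K)
    (y : Fin m → ℝ) : |F (fun _ => y)| ≤ (m : ℝ) ^ k * (‖y‖ ^ k * K) := by
  rw [aux_diag_expand]
  refine (Finset.abs_sum_le_sum_abs _ _).trans ?_
  have : ∀ idx ∈ (Finset.univ : Finset (Fin k → Fin m)),
      |(∏ l, y (idx l)) * F (fun l => Pi.single (idx l) 1)| ≤ ‖y‖ ^ k * K := by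
    intro idx _
    rw [abs_mul, Finset.abs_prod]
    refine mul_le_mul ?_ (hK idx) (abs_nonneg _) (by positivity)
    refine (Finset.prod_le_prod (fun _ _ => abs_nonneg _)
      (fun l _ => norm_le_pi_norm y (idx l))).trans ?_
    simp
  refine (Finset.sum_le_sum this).trans ?_
  simp

/-- Fourth order Taylor expansion with a fifth order bound on the remainder. -/
lemma aux_taylor {m : ℕ} (θ : Fin m → ℝ) (R : (Fin m → ℝ) → ℝ) (hR : ContDiff ℝ 5 R)
    (hC1 : fderiv ℝ R θ = 0) (K : ℝ)
    (hK : ∀ (x : Fin m → ℝ) (idx : Fin 5 → Fin m),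
      |iteratedFDeriv ℝ 5 R x (fun l => Pi.single (idx l) 1)| ≤ K) (y : Fin m → ℝ) :
    |R (θ + y) - (R θ + (1/2) * iteratedFDeriv ℝ 2 R θ (fun _ => y)
      + (1/6) * iteratedFDeriv ℝ 3 R θ (fun _ => y)
      + (1/24) * iteratedFDeriv ℝ 4 R θ (fun _ => y))| ≤ (m : ℝ) ^ 5 * (‖y‖ ^ 5 * K) := by
  have h := map_add_eq_sum_add_integral_iteratedFDeriv (n := 4) (f := R) (x := θ) (y := y)
    (fun t _ => by simpa using (hR.contDiffAt.of_le (by norm_num)))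
  rw [h]
  have h1 : iteratedFDeriv ℝ 1 R θ (fun _ => y) = 0 := by
    simp [iteratedFDeriv_one_apply, hC1]
  simp only [Finset.sum_range_succ, Finset.sum_range_zero, h1]
  have hb : ‖∫ t in (0:ℝ)..1, (1 - t)^4 • iteratedFDeriv ℝ (4 + 1) R (θ + t • y) (fun _ ↦ y)‖
      ≤ (m : ℝ) ^ 5 * (‖y‖ ^ 5 * K) * |1 - 0| := by
    refine intervalIntegral.norm_integral_le_of_norm_le_const fun t ht => ?_
    rw [Set.uIoc_of_le zero_le_one] at ht
    have := aux_diag_bound (iteratedFDeriv ℝ 5 R (θ + t • y)) K (hK _) y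
    rw [norm_smul, Real.norm_eq_abs, Real.norm_eq_abs]
    have h4 : |(1 - t)^4| ≤ 1 := by
      rw [abs_pow]
      refine pow_le_one₀ (abs_nonneg _) ?_
      rw [abs_le]; constructor <;> linarith [ht.1, ht.2]
    calc _ ≤ 1 * ((m : ℝ) ^ 5 * (‖y‖ ^ 5 * K)) :=
          mul_le_mul h4 this (abs_nonneg _) zero_le_one
      _ = _ := one_mul _
  rw [Real.norm_eq_abs] at hb
  set J := ∫ t in (0:ℝ)..1, (1 - t)^4 • iteratedFDeriv ℝ (4 + 1) R (θ + t • y) (fun _ ↦ y)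
  have e : ∀ a b c d : ℝ, (a + 0 + b + c + d + (Nat.factorial 4 : ℝ)⁻¹ • J) - (a + b + c + d) = J / 24 := by
    intro a b c d
    simp [Nat.factorial]; ring
  have : ∀ z : ℝ, z = J / 24 → |z| ≤ (m : ℝ) ^ 5 * (‖y‖ ^ 5 * K) := by
    rintro z rfl
    rw [abs_div]
    have := abs_nonneg J
    norm_num at hb ⊢
    linarith
  apply this
  simp [Nat.factorial]
  ring

lemma aux_symm2 {m : ℕ} (θ : Fin m → ℝ) (R : (Fin m → ℝ) → ℝ) (hR : ContDiff ℝ 5 R)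
    (a b : Fin m → ℝ) : iteratedFDeriv ℝ 2 R θ ![a, b] = iteratedFDeriv ℝ 2 R θ ![b, a] := by
  have := (hR.contDiffAt (x := θ)).isSymmSndFDerivAt (by simp; norm_num)
  simpa [iteratedFDeriv_two_apply] using this a b

lemma aux_symm3a {m : ℕ} (θ : Fin m → ℝ) (R : (Fin m → ℝ) → ℝ) (hR : ContDiff ℝ 5 R)
    (a b c : Fin m → ℝ) :
    iteratedFDeriv ℝ 3 R θ ![a, b, c] = iteratedFDeriv ℝ 3 R θ ![a, c, b] := by
  have hd : DifferentiableAt ℝ (iteratedFDeriv ℝ 2 R) θ :=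
    hR.differentiable_iteratedFDeriv (by norm_num) θ
  have h1 := hd.iteratedFDeriv_succ_apply_left' (m := ![a, b, c])
  have h2 := hd.iteratedFDeriv_succ_apply_left' (m := ![a, c, b])
  rw [h1, h2]
  simp only [Matrix.cons_val_zero, Fin.tail_def]
  congr 2
  funext x
  have := aux_symm2 x R hR b c
  convert this using 2 <;> ext i j <;> fin_cases i <;> rfl

lemma aux_symm3b {m : ℕ} (θ : Fin m → ℝ) (R : (Fin m → ℝ) → ℝ) (hR : ContDiff ℝ 5 R)
    (a b c : Fin m → ℝ) :
    iteratedFDeriv ℝ 3 R θ ![a, b, c] = iteratedFDeriv ℝ 3 R θ ![b, a, c] := by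
  have hf : ContDiff ℝ 4 (fderiv ℝ R) := hR.fderiv_right (by norm_num)
  have := (hf.contDiffAt (x := θ)).isSymmSndFDerivAt (by simp; norm_num)
  have e1 : iteratedFDeriv ℝ 2 (fderiv ℝ R) θ ![a, b] = iteratedFDeriv ℝ 2 (fderiv ℝ R) θ ![b, a] := by
    simpa [iteratedFDeriv_two_apply] using this a b
  have e2 := iteratedFDeriv_succ_apply_right (𝕜 := ℝ) (n := 2) (f := R) (x := θ) ![a, b, c]
  have e3 := iteratedFDeriv_succ_apply_right (𝕜 := ℝ) (n := 2) (f := R) (x := θ) ![b, a, c]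
  have i1 : Fin.init ![a, b, c] = ![a, b] := by ext i j; fin_cases i <;> rfl
  have i2 : Fin.init ![b, a, c] = ![b, a] := by ext i j; fin_cases i <;> rfl
  rw [i1] at e2
  rw [i2] at e3
  refine e2.trans (Eq.trans ?_ e3.symm)
  exact congrArg (fun f => f c) e1

lemma aux_sum2 {m : ℕ} (f : Fin m → Fin m → ℝ) :
    ∑ idx : Fin 2 → Fin m, f (idx 0) (idx 1) = ∑ i, ∑ j, f i j := by
  rw [← Fintype.sum_prod_type']
  exact Fintype.sum_equiv (finTwoArrowEquiv (Fin m)) _ _ (fun _ => rfl)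

lemma aux_sum3 {m : ℕ} (f : Fin m → Fin m → Fin m → ℝ) :
    ∑ idx : Fin 3 → Fin m, f (idx 0) (idx 1) (idx 2) = ∑ i, ∑ j, ∑ k, f i j k := by
  rw [← Equiv.sum_comp (Fin.consEquiv (fun _ : Fin 3 => Fin m)), Fintype.sum_prod_type]
  refine Finset.sum_congr rfl fun i _ => ?_
  rw [← aux_sum2]
  rfl

/-- `n² E f_n → L`, with all `f_n` integrable. -/
def AuxML {Ω : Type*} [MeasurableSpace Ω] (μ : Measure Ω) (f : ℕ → Ω → ℝ) (L : ℝ) : Prop :=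
  (∀ n, Integrable (f n) μ) ∧ Tendsto (fun n : ℕ => (n : ℝ) ^ 2 * ∫ ω, f n ω ∂μ) atTop (nhds L)

section ML
variable {Ω : Type*} [MeasurableSpace Ω] {μ : Measure Ω}

lemma AuxML.add {f g : ℕ → Ω → ℝ} {a b : ℝ} (hf : AuxML μ f a) (hg : AuxML μ g b) :
    AuxML μ (fun n ω => f n ω + g n ω) (a + b) := by
  refine ⟨fun n => (hf.1 n).add (hg.1 n), ?_⟩
  refine (hf.2.add hg.2).congr fun n => ?_
  rw [integral_add (hf.1 n) (hg.1 n)]; ring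

lemma AuxML.smul {f : ℕ → Ω → ℝ} {a : ℝ} (hf : AuxML μ f a) {c : ℕ → ℝ} {C : ℝ}
    (hc : Tendsto c atTop (nhds C)) :
    AuxML μ (fun n ω => c n * f n ω) (C * a) := by
  refine ⟨fun n => (hf.1 n).const_mul _, ?_⟩
  refine (hc.mul hf.2).congr fun n => ?_
  rw [integral_const_mul]; ring

lemma AuxML.congr {f g : ℕ → Ω → ℝ} {a b : ℝ} (hf : AuxML μ f a) (h : ∀ n ω, g n ω = f n ω)
    (hab : b = a) : AuxML μ g b := by
  have : g = f := by funext n ω; exact h n ω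
  rw [this, hab]; exact hf

lemma AuxML.sum {ι : Type*} [Fintype ι] {f : ι → ℕ → Ω → ℝ} {a : ι → ℝ}
    (hf : ∀ i, AuxML μ (f i) (a i)) :
    AuxML μ (fun n ω => ∑ i, f i n ω) (∑ i, a i) := by
  refine ⟨fun n => integrable_finsetSum _ fun i _ => (hf i).1 n, ?_⟩
  refine (tendsto_finsetSum _ fun i _ => (hf i).2).congr fun n => ?_
  rw [integral_finsetSum _ fun i _ => (hf i).1 n, Finset.mul_sum]

end ML

section ML2
variable {Ω : Type*} [MeasurableSpace Ω] {μ : Measure Ω}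

lemma AuxML.smulc {f : ℕ → Ω → ℝ} {a : ℝ} (hf : AuxML μ f a) (g : ℝ → ℝ) (hg : Continuous g) :
    AuxML μ (fun n ω => g ((n : ℝ)⁻¹) * f n ω) (g 0 * a) := by
  refine hf.smul ?_
  exact (hg.tendsto 0).comp tendsto_inv_atTop_nhds_zero_nat

lemma AuxML.of_le {f g : ℕ → Ω → ℝ} (hg : AuxML μ g 0) (hf : ∀ n, Integrable (f n) μ)
    (h : ∀ᶠ n in atTop, ∀ ω, |f n ω| ≤ g n ω) : AuxML μ f 0 := by
  refine ⟨hf, ?_⟩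
  refine squeeze_zero_norm' ?_ hg.2
  filter_upwards [h] with n hn
  rw [Real.norm_eq_abs, abs_mul, abs_of_nonneg (by positivity : (0:ℝ) ≤ (n:ℝ)^2)]
  refine mul_le_mul_of_nonneg_left ?_ (by positivity)
  refine (abs_integral_le_integral_abs).trans ?_
  exact integral_mono (hf n).abs (hg.1 n) hn

lemma aux_O (E c : ℕ → ℝ) (p a : ℝ) (hE : E =O[atTop] fun n : ℕ => (n : ℝ) ^ (-p)) (hap : a < p)
    (hc : ∀ᶠ n : ℕ in atTop, c n = (n : ℝ) ^ a) :
    Tendsto (fun n => c n * E n) atTop (nhds 0) := by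
  have hc' : c =O[atTop] fun n : ℕ => (n : ℝ) ^ a := EventuallyEq.isBigO hc
  have h := hc'.mul hE
  refine h.trans_tendsto ?_
  have h1 : Tendsto (fun n : ℕ => (n : ℝ) ^ (-(p - a))) atTop (nhds 0) :=
    (tendsto_rpow_neg_atTop (by linarith)).comp tendsto_natCast_atTop_atTop
  refine h1.congr' ?_
  filter_upwards [eventually_gt_atTop 0] with n hn
  have : (0:ℝ) < n := by exact_mod_cast hn
  rw [← Real.rpow_add this]
  congr 1; ring

variable [IsProbabilityMeasure μ]

lemma aux_M0 : AuxML μ (fun n _ => ((n : ℝ)⁻¹) ^ 2) 1 := by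
  refine ⟨fun n => integrable_const _, ?_⟩
  refine tendsto_const_nhds.congr' ?_
  filter_upwards [eventually_gt_atTop 0] with n hn
  have : (n:ℝ) ≠ 0 := by exact_mod_cast hn.ne'
  simp [this]

/-- Second order product limit. -/
lemma aux_lim2 {x y : ℕ → Ω → ℝ} {S : ℝ} (li lj ti tj : ℝ)
    (hx : AuxML μ (fun n ω => (n : ℝ)⁻¹ * x n ω) 0)
    (hy : AuxML μ (fun n ω => (n : ℝ)⁻¹ * y n ω) 0)
    (hxy : AuxML μ (fun n ω => (n : ℝ)⁻¹ * (x n ω * y n ω)) S) :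
    AuxML μ (fun n ω => ((1 + (n : ℝ)⁻¹ * li) * x n ω + (n : ℝ)⁻¹ * ti) *
      ((1 + (n : ℝ)⁻¹ * lj) * y n ω + (n : ℝ)⁻¹ * tj) - x n ω * y n ω)
      ((li + lj) * S + ti * tj) := by
  have h := ((hxy.smulc (fun e => li + lj + e * (li * lj)) (by fun_prop)).add
    ((hx.smulc (fun e => (1 + e * li) * tj) (by fun_prop)).add
    (hy.smulc (fun e => (1 + e * lj) * ti) (by fun_prop)))).add
    ((aux_M0 (μ := μ)).smulc (fun _ => ti * tj) (by fun_prop))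
  refine h.congr (fun n ω => by ring) (by ring)

/-- Third order product limit. -/
lemma aux_lim3 {x y z : ℕ → Ω → ℝ} {S1 S2 S3 : ℝ} (li lj lk ti tj tk : ℝ)
    (hx : AuxML μ (fun n ω => (n : ℝ)⁻¹ * x n ω) 0)
    (hy : AuxML μ (fun n ω => (n : ℝ)⁻¹ * y n ω) 0)
    (hz : AuxML μ (fun n ω => (n : ℝ)⁻¹ * z n ω) 0)
    (hyz : AuxML μ (fun n ω => (n : ℝ)⁻¹ * (y n ω * z n ω)) S1)
    (hxz : AuxML μ (fun n ω => (n : ℝ)⁻¹ * (x n ω * z n ω)) S2)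
    (hxy : AuxML μ (fun n ω => (n : ℝ)⁻¹ * (x n ω * y n ω)) S3)
    (hxyz : AuxML μ (fun n ω => (n : ℝ)⁻¹ * (x n ω * y n ω * z n ω)) 0) :
    AuxML μ (fun n ω => ((1 + (n : ℝ)⁻¹ * li) * x n ω + (n : ℝ)⁻¹ * ti) *
      ((1 + (n : ℝ)⁻¹ * lj) * y n ω + (n : ℝ)⁻¹ * tj) *
      ((1 + (n : ℝ)⁻¹ * lk) * z n ω + (n : ℝ)⁻¹ * tk) - x n ω * y n ω * z n ω)
      (ti * S1 + tj * S2 + tk * S3) := by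
  have h := (((hxyz.smulc (fun e => li + lj + lk + e * (li * lj + li * lk + lj * lk)
      + e ^ 2 * (li * lj * lk)) (by fun_prop)).add
    (((hyz.smulc (fun e => (1 + e * lj) * (1 + e * lk) * ti) (by fun_prop)).add
    (hxz.smulc (fun e => (1 + e * li) * (1 + e * lk) * tj) (by fun_prop))).add
    (hxy.smulc (fun e => (1 + e * li) * (1 + e * lj) * tk) (by fun_prop)))).add
    (((hx.smulc (fun e => e * (1 + e * li) * tj * tk) (by fun_prop)).add
    (hy.smulc (fun e => e * (1 + e * lj) * ti * tk) (by fun_prop))).add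
    (hz.smulc (fun e => e * (1 + e * lk) * ti * tj) (by fun_prop)))).add
    ((aux_M0 (μ := μ)).smulc (fun e => e * (ti * tj * tk)) (by fun_prop))
  refine h.congr (fun n ω => by ring) (by ring)

/-- Fourth order product limit. -/
lemma aux_lim4 {x : Fin 4 → ℕ → Ω → ℝ} {S : Fin 4 → Fin 4 → ℝ} (l t : Fin 4 → ℝ)
    (h1 : ∀ i, AuxML μ (fun n ω => (n : ℝ)⁻¹ * x i n ω) 0)
    (h2 : ∀ i j, AuxML μ (fun n ω => (n : ℝ)⁻¹ * (x i n ω * x j n ω)) (S i j))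
    (h3 : ∀ i j k, AuxML μ (fun n ω => (n : ℝ)⁻¹ * (x i n ω * x j n ω * x k n ω)) 0)
    (h4 : AuxML μ (fun n ω => (n : ℝ)⁻¹ * (x 0 n ω * x 1 n ω * x 2 n ω * x 3 n ω)) 0) :
    AuxML μ (fun n ω => ((1 + (n : ℝ)⁻¹ * l 0) * x 0 n ω + (n : ℝ)⁻¹ * t 0) *
      ((1 + (n : ℝ)⁻¹ * l 1) * x 1 n ω + (n : ℝ)⁻¹ * t 1) *
      ((1 + (n : ℝ)⁻¹ * l 2) * x 2 n ω + (n : ℝ)⁻¹ * t 2) *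
      ((1 + (n : ℝ)⁻¹ * l 3) * x 3 n ω + (n : ℝ)⁻¹ * t 3)
        - x 0 n ω * x 1 n ω * x 2 n ω * x 3 n ω) 0 := by
  have a4 := h4.smulc (fun e => l 0 + l 1 + l 2 + l 3
      + e * (l 0 * l 1 + l 0 * l 2 + l 0 * l 3 + l 1 * l 2 + l 1 * l 3 + l 2 * l 3)
      + e ^ 2 * (l 0 * l 1 * l 2 + l 0 * l 1 * l 3 + l 0 * l 2 * l 3 + l 1 * l 2 * l 3)
      + e ^ 3 * (l 0 * l 1 * l 2 * l 3)) (by fun_prop)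
  have a3 : ∀ i j k r, AuxML μ (fun n ω => ((1 + (n : ℝ)⁻¹ * l i) * (1 + (n : ℝ)⁻¹ * l j) *
      (1 + (n : ℝ)⁻¹ * l k) * t r) * ((n : ℝ)⁻¹ * (x i n ω * x j n ω * x k n ω))) 0 := fun i j k r =>
    ((h3 i j k).smulc (fun e => (1 + e * l i) * (1 + e * l j) * (1 + e * l k) * t r)
      (by fun_prop)).congr (fun _ _ => rfl) (by ring)
  have a2 : ∀ i j k r, AuxML μ (fun n ω => ((n : ℝ)⁻¹ * (1 + (n : ℝ)⁻¹ * l i) *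
      (1 + (n : ℝ)⁻¹ * l j) * t k * t r) * ((n : ℝ)⁻¹ * (x i n ω * x j n ω))) 0 := fun i j k r =>
    ((h2 i j).smulc (fun e => e * (1 + e * l i) * (1 + e * l j) * t k * t r)
      (by fun_prop)).congr (fun _ _ => rfl) (by ring)
  have a1 : ∀ i j k r, AuxML μ (fun n ω => ((n : ℝ)⁻¹ ^ 2 * (1 + (n : ℝ)⁻¹ * l i) *
      t j * t k * t r) * ((n : ℝ)⁻¹ * x i n ω)) 0 := fun i j k r =>
    ((h1 i).smulc (fun e => e ^ 2 * (1 + e * l i) * t j * t k * t r)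
      (by fun_prop)).congr (fun _ _ => rfl) (by ring)
  have a0 := (aux_M0 (μ := μ)).smulc (fun e => e ^ 2 * (t 0 * t 1 * t 2 * t 3)) (by fun_prop)
  have b3 := (((a3 0 1 2 3).add (a3 0 1 3 2)).add (a3 0 2 3 1)).add (a3 1 2 3 0)
  have b2 := (((((a2 0 1 2 3).add (a2 0 2 1 3)).add (a2 0 3 1 2)).add (a2 1 2 0 3)).add
    (a2 1 3 0 2)).add (a2 2 3 0 1)
  have b1 := (((a1 0 1 2 3).add (a1 1 0 2 3)).add (a1 2 0 1 3)).add (a1 3 0 1 2)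
  exact ((((a4.add b3).add b2).add b1).add a0).congr (fun n ω => by ring) (by ring)

end ML2

lemma aux_five (e s l t x : ℝ) (he0 : 0 ≤ e) (he1 : e ≤ 1) (hs : 0 < s) :
    |(1 + e * l) * x + e * t| ^ 5 ≤
      (1 + |l| + |t|) ^ 5 * 16 * (s * x ^ 6 + s⁻¹ * x ^ 4 + e ^ 5) := by
  have h1 : |(1 + e * l) * x + e * t| ≤ (1 + |l| + |t|) * (|x| + e) := by
    refine (abs_add_le _ _).trans ?_
    rw [abs_mul, abs_mul, abs_of_nonneg he0]
    have h2 : |1 + e * l| ≤ 1 + |l| := by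
      refine (abs_add_le _ _).trans ?_
      rw [abs_one, abs_mul, abs_of_nonneg he0]
      nlinarith [abs_nonneg l]
    have := mul_le_mul_of_nonneg_right h2 (abs_nonneg x)
    have := mul_nonneg (abs_nonneg t) (abs_nonneg x)
    have := mul_nonneg (abs_nonneg l) he0
    nlinarith
  have h2 : (|x| + e) ^ 5 ≤ 16 * (|x| ^ 5 + e ^ 5) := by
    have := add_pow_le (abs_nonneg x) he0 5
    norm_num at this
    linarith
  have h3 : |x| ^ 5 ≤ s * x ^ 6 + s⁻¹ * x ^ 4 := by
    have e6 : x ^ 6 = |x| ^ 6 := (Even.pow_abs (by decide) x).symm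
    have e4 : x ^ 4 = |x| ^ 4 := (Even.pow_abs (by decide) x).symm
    rw [e6, e4]
    have : 0 ≤ |x| ^ 4 * s⁻¹ * ((s * |x| - 1) ^ 2 + s * |x|) := by positivity
    have h : |x| ^ 4 * s⁻¹ * ((s * |x| - 1) ^ 2 + s * |x|)
      = s * |x| ^ 6 + s⁻¹ * |x| ^ 4 - |x| ^ 5 := by
      field_simp; ring
    linarith
  calc _ ≤ ((1 + |l| + |t|) * (|x| + e)) ^ 5 := pow_le_pow_left₀ (abs_nonneg _) h1 5
    _ = (1 + |l| + |t|) ^ 5 * (|x| + e) ^ 5 := by ring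
    _ ≤ (1 + |l| + |t|) ^ 5 * (16 * (s * x ^ 6 + s⁻¹ * x ^ 4 + e ^ 5)) := by
      refine mul_le_mul_of_nonneg_left ?_ (by positivity)
      linarith
    _ = _ := by ring

lemma aux_norm_pow {m : ℕ} (y : Fin m → ℝ) : ‖y‖ ^ 5 ≤ ∑ i, |y i| ^ 5 := by
  rcases isEmpty_or_nonempty (Fin m) with h | h
  · simp [Subsingleton.elim y 0]
  · obtain ⟨i, hi⟩ := Finite.exists_max (fun i => ‖y i‖)
    have h1 : ‖y‖ ≤ |y i| := (pi_norm_le_iff_of_nonneg (norm_nonneg _)).2 hi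
    refine (pow_le_pow_left₀ (norm_nonneg _) h1 5).trans ?_
    exact Finset.single_le_sum (f := fun i => |y i| ^ 5) (fun _ _ => by positivity)
      (Finset.mem_univ i)

lemma aux_max {m : ℕ} (A : Matrix (Fin m) (Fin m) ℝ) (hs : ∀ i j, A i j = A j i) (b : Fin m → ℝ)
    (hneg : ∀ x : Fin m → ℝ, x ≠ 0 → ∑ i, ∑ j, x i * A i j * x j < 0)
    (s : Fin m → ℝ) (hsd : s = (fun i => -(1 / 2) * ∑ j, A⁻¹ i j * b j)) (l : Fin m → ℝ)
    (hl : l ≠ s) :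
    (∑ i, ∑ j, l i * A i j * l j) + ∑ i, b i * l i <
      (∑ i, ∑ j, s i * A i j * s j) + ∑ i, b i * s i := by
  have hinv : IsUnit A.det := by
    rw [← Matrix.isUnit_iff_isUnit_det, ← Matrix.mulVec_injective_iff_isUnit]
    intro x y hxy
    by_contra hne
    have hz : A.mulVec (x - y) = 0 := by
      rw [Matrix.mulVec_sub]; exact sub_eq_zero.2 hxy
    have := hneg (x - y) (sub_ne_zero.2 hne)
    have h0 : ∑ i, ∑ j, (x - y) i * A i j * (x - y) j = 0 := by
      refine Finset.sum_eq_zero fun i _ => ?_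
      have := congrFun hz i
      simp only [Matrix.mulVec, dotProduct, Pi.zero_apply] at this
      simp_rw [mul_assoc, ← Finset.mul_sum, this, mul_zero]
    linarith
  have hAs : ∀ i, ∑ j, A i j * s j = -(1/2) * b i := by
    have : A.mulVec s = (-(1/2 : ℝ)) • b := by
      have : s = (-(1/2 : ℝ)) • A⁻¹.mulVec b := by
        rw [hsd]; ext i; simp [Matrix.mulVec, dotProduct]
      rw [this, Matrix.mulVec_smul, Matrix.mulVec_mulVec, Matrix.mul_nonsing_inv _ hinv,
        Matrix.one_mulVec]
    intro i
    have := congrFun this i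
    simpa [Matrix.mulVec, dotProduct] using this
  have key := hneg (l - s) (sub_ne_zero.2 hl)
  have c1 : ∀ u : Fin m → ℝ, ∑ i, ∑ j, u i * A i j * s j = -(1/2) * ∑ i, b i * u i := by
    intro u
    simp_rw [mul_assoc, ← Finset.mul_sum, hAs, Finset.mul_sum]
    exact Finset.sum_congr rfl fun i _ => by ring
  have c2 : ∑ i, ∑ j, s i * A i j * l j = -(1/2) * ∑ i, b i * l i := by
    rw [← c1 l, Finset.sum_comm]
    refine Finset.sum_congr rfl fun i _ => Finset.sum_congr rfl fun j _ => ?_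
    rw [hs j i]; ring
  have ex : ∑ i, ∑ j, (l - s) i * A i j * (l - s) j =
      ∑ i, ∑ j, l i * A i j * l j - ∑ i, ∑ j, l i * A i j * s j
      - ∑ i, ∑ j, s i * A i j * l j + ∑ i, ∑ j, s i * A i j * s j := by
    simp_rw [← Finset.sum_sub_distrib, ← Finset.sum_add_distrib]
    refine Finset.sum_congr rfl fun i _ => Finset.sum_congr rfl fun j _ => ?_
    simp only [Pi.sub_apply]; ring
  rw [ex, c1, c2, c1] at key
  rw [c1]
  linarith

/-- Multi-parameter oracle adjustment: under estimator regularity (B1)–(B3)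
and reward-structure conditions (C1)–(C3), for every diagonal adjustment `Λ = diag(λ)` the
asymptotic improvement over PTO equals `(1/2)(λᵀAλ + bᵀλ)` with `A_{ij} = H_{ij}θ_iθ_j` and
`b = (H ⊙ (2Σ + M))𝟙`; if `A` is negative definite the unique maximizer is
`λ* = −(1/2)A⁻¹b`. -/
theorem stmt_16
    {Ω : Type*} [MeasurableSpace Ω] (μ : Measure Ω) [IsProbabilityMeasure μ]
    (m : ℕ) (hm : 0 < m) (θ : Fin m → ℝ)
    (θhat : ℕ → Ω → Fin m → ℝ) (hmeas : ∀ n, Measurable (θhat n))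
    (hmom : ∀ (n k : ℕ) (idx : Fin k → Fin m),
      Integrable (fun ω => ∏ l : Fin k, (θhat n ω (idx l) - θ (idx l))) μ)
    -- (B1) diminishing bias, coordinatewise (equivalently in the max norm)
    (hB1 : ∀ i, (fun n : ℕ => ∫ ω, (θhat n ω i - θ i) ∂μ) =o[atTop]
      fun n : ℕ => (n : ℝ)⁻¹)
    (Sig : Matrix (Fin m) (Fin m) ℝ)
    -- (B2) root-n covariance
    (hB2 : ∀ i j, Tendsto
      (fun n : ℕ => (n : ℝ) * ∫ ω, (θhat n ω i - θ i) * (θhat n ω j - θ j) ∂μ)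
      atTop (nhds (Sig i j)))
    -- (B3) higher moment tensors, entrywise (equivalently for the max entry)
    (hB3 : ∀ k : ℕ, 3 ≤ k → ∀ idx : Fin k → Fin m,
      (fun n : ℕ => ∫ ω, ∏ l : Fin k, (θhat n ω (idx l) - θ (idx l)) ∂μ) =O[atTop]
        fun n : ℕ => (n : ℝ) ^ (-(k : ℝ) / 2))
    (R : (Fin m → ℝ) → ℝ) (hR : ContDiff ℝ 5 R)
    -- (C1) vanishing gradient at θ
    (hC1 : fderiv ℝ R θ = 0)
    -- Hessian and third-derivative tensor of R at θ
    (H : Matrix (Fin m) (Fin m) ℝ)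
    (hH : ∀ i j, H i j =
      iteratedFDeriv ℝ 2 R θ ![Pi.single i 1, Pi.single j 1])
    (T : Fin m → Fin m → Fin m → ℝ)
    (hT : ∀ i j k, T i j k =
      iteratedFDeriv ℝ 3 R θ ![Pi.single i 1, Pi.single j 1, Pi.single k 1])
    -- (C2) the structural condition ⟨H, ΛM⟩ = ⟨∇³R(θ), (Λθ) ⊗ Σ⟩ for diagonal Λ
    (M : Matrix (Fin m) (Fin m) ℝ)
    (hC2 : ∀ l : Fin m → ℝ,
      ∑ i, ∑ j, H i j * (l i * M i j)
        = ∑ i, ∑ j, ∑ k, T i j k * (l i * θ i) * Sig j k)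
    -- (C3) uniformly bounded fifth derivative (max entry of the tensor)
    (hC3 : ∃ K : ℝ, ∀ (x : Fin m → ℝ) (idx : Fin 5 → Fin m),
      |iteratedFDeriv ℝ 5 R x (fun l => Pi.single (idx l) 1)| ≤ K)
    (A : Matrix (Fin m) (Fin m) ℝ) (hA : ∀ i j, A i j = H i j * θ i * θ j)
    (b : Fin m → ℝ) (hb : ∀ i, b i = ∑ j, H i j * (2 * Sig i j + M i j))
    (q : (Fin m → ℝ) → ℝ)
    (hq : ∀ l : Fin m → ℝ,
      q l = 1 / 2 * ((∑ i, ∑ j, l i * A i j * l j) + ∑ i, b i * l i))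
    -- expectations of the rewards exist
    (hRint : ∀ (n : ℕ) (l : Fin m → ℝ),
      Integrable (fun ω => R (fun i => (1 + l i / (n : ℝ)) * θhat n ω i)) μ)
    (hRint0 : ∀ n : ℕ, Integrable (fun ω => R (θhat n ω)) μ) :
    (∀ l : Fin m → ℝ,
      Tendsto
        (fun n : ℕ => (n : ℝ) ^ 2 *
          ((∫ ω, R (fun i => (1 + l i / (n : ℝ)) * θhat n ω i) ∂μ) -
            ∫ ω, R (θhat n ω) ∂μ))
        atTop (nhds (q l))) ∧
    ((∀ x : Fin m → ℝ, x ≠ 0 → ∑ i, ∑ j, x i * A i j * x j < 0) →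
      ∀ lstar : Fin m → ℝ, lstar = (fun i => -(1 / 2) * ∑ j, A⁻¹ i j * b j) →
        ∀ l : Fin m → ℝ, l ≠ lstar → q l < q lstar) := by
  have hHs : ∀ i j, H i j = H j i := fun i j => by
    rw [hH, hH]; exact aux_symm2 θ R hR _ _
  have hTa : ∀ i j k, T i j k = T i k j := fun i j k => by
    rw [hT, hT]; exact aux_symm3a θ R hR _ _ _
  have hTb : ∀ i j k, T i j k = T j i k := fun i j k => by
    rw [hT, hT]; exact aux_symm3b θ R hR _ _ _
  refine ⟨?_, ?_⟩
  swap
  · intro hneg s hs l hl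
    rw [hq, hq]
    have := aux_max A (fun i j => by rw [hA, hA, hHs i j]; ring) b hneg s hs l hl
    linarith
  intro l
  obtain ⟨K, hK⟩ := hC3
  have hSs : ∀ i j, Sig i j = Sig j i := fun i j =>
    tendsto_nhds_unique (hB2 i j) ((hB2 j i).congr fun n => by
      congr 2; funext ω; ring)
  -- basic moments
  have npos : ∀ᶠ n : ℕ in atTop, (0:ℝ) < n := by
    filter_upwards [eventually_gt_atTop 0] with n hn
    exact_mod_cast hn
  set X : ℕ → Ω → Fin m → ℝ := fun n ω i => θhat n ω i - θ i with hX
  have hpow : ∀ (k : ℕ), 3 ≤ k → ∀ idx : Fin k → Fin m, ∀ (c : ℕ → ℝ) (a : ℝ),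
      a + 2 < (k : ℝ) / 2 → (∀ᶠ n : ℕ in atTop, c n = (n : ℝ) ^ a) →
      AuxML μ (fun n ω => c n * ∏ r, X n ω (idx r)) 0 := by
    intro k hk idx c a ha hc
    refine ⟨fun n => (hmom n k idx).const_mul _, ?_⟩
    have h := aux_O _ (fun n : ℕ => (n:ℝ)^2 * c n) ((k:ℝ)/2) (a + 2)
      (by simpa only [neg_div] using hB3 k hk idx) ha (by
        filter_upwards [hc, npos] with n hn h0
        rw [hn, Real.rpow_add h0, Real.rpow_two]; ring)
    refine h.congr fun n => ?_
    rw [integral_const_mul]; ring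
  have hinv : ∀ᶠ n : ℕ in atTop, (n:ℝ)⁻¹ = (n:ℝ) ^ (-1:ℝ) := by
    filter_upwards with n
    rw [Real.rpow_neg_one]
  have X1 : ∀ i, AuxML μ (fun n ω => (n:ℝ)⁻¹ * X n ω i) 0 := by
    intro i
    refine ⟨fun n => ?_, ?_⟩
    · have := hmom n 1 (fun _ => i)
      simp only [Finset.univ_unique, Finset.prod_singleton] at this
      exact this.const_mul _
    · have := (hB1 i).tendsto_div_nhds_zero
      refine this.congr' ?_
      filter_upwards [npos] with n hn
      rw [integral_const_mul]
      field_simp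
      rfl
  have X2 : ∀ i j, AuxML μ (fun n ω => (n:ℝ)⁻¹ * (X n ω i * X n ω j)) (Sig i j) := by
    intro i j
    refine ⟨fun n => ?_, ?_⟩
    · have := hmom n 2 ![i, j]
      simp only [Fin.prod_univ_two, Matrix.cons_val_zero, Matrix.cons_val_one] at this
      exact this.const_mul _
    · refine (hB2 i j).congr' ?_
      filter_upwards [npos] with n hn
      rw [integral_const_mul]
      field_simp
      rfl
  have X3 : ∀ i j k, AuxML μ (fun n ω => (n:ℝ)⁻¹ * (X n ω i * X n ω j * X n ω k)) 0 := by
    intro i j k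
    refine (hpow 3 le_rfl ![i, j, k] _ (-1) (by norm_num) hinv).congr (fun n ω => ?_) rfl
    simp [Fin.prod_univ_three]
  have X4 : ∀ i j k r, AuxML μ
      (fun n ω => (n:ℝ)⁻¹ * (X n ω i * X n ω j * X n ω k * X n ω r)) 0 := by
    intro i j k r
    refine (hpow 4 (by norm_num) ![i, j, k, r] _ (-1) (by norm_num) hinv).congr
      (fun n ω => ?_) rfl
    simp [Fin.prod_univ_four]
  have X4' : ∀ i, AuxML μ (fun n ω => (√(n:ℝ))⁻¹ * X n ω i ^ 4) 0 := by
    intro i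
    refine (hpow 4 (by norm_num) (fun _ => i) (fun n => (√(n:ℝ))⁻¹) (-(1/2)) (by norm_num) ?_).congr
      (fun n ω => ?_) rfl
    · filter_upwards [npos] with n hn
      rw [Real.rpow_neg hn.le, Real.sqrt_eq_rpow]
    · simp
  have X6 : ∀ i, AuxML μ (fun n ω => √(n:ℝ) * X n ω i ^ 6) 0 := by
    intro i
    refine (hpow 6 (by norm_num) (fun _ => i) (fun n => √(n:ℝ)) (1/2) (by norm_num) ?_).congr
      (fun n ω => ?_) rfl
    · filter_upwards [npos] with n hn
      rw [Real.sqrt_eq_rpow]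
    · simp
  -- the adjusted deviation
  set Y : ℕ → Ω → Fin m → ℝ :=
    fun n ω i => (1 + (n:ℝ)⁻¹ * l i) * X n ω i + (n:ℝ)⁻¹ * (l i * θ i) with hY
  have eY : ∀ (n : ℕ) ω, (fun i => (1 + l i / (n : ℝ)) * θhat n ω i) = θ + Y n ω := by
    intro n ω; funext i; simp only [hY, hX, Pi.add_apply]; ring
  have eX : ∀ n ω, θhat n ω = θ + X n ω := by
    intro n ω; funext i; simp only [hX, Pi.add_apply]; ring
  -- polynomial terms
  have P2 := AuxML.sum (μ := μ) (fun idx : Fin 2 → Fin m =>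
    (aux_lim2 (l (idx 0)) (l (idx 1)) (l (idx 0) * θ (idx 0)) (l (idx 1) * θ (idx 1))
      (X1 (idx 0)) (X1 (idx 1)) (X2 (idx 0) (idx 1))).smulc
      (fun _ => iteratedFDeriv ℝ 2 R θ (fun r => Pi.single (idx r) 1)) continuous_const)
  have P3 := AuxML.sum (μ := μ) (fun idx : Fin 3 → Fin m =>
    (aux_lim3 (l (idx 0)) (l (idx 1)) (l (idx 2)) (l (idx 0) * θ (idx 0))
      (l (idx 1) * θ (idx 1)) (l (idx 2) * θ (idx 2))
      (X1 (idx 0)) (X1 (idx 1)) (X1 (idx 2)) (X2 (idx 1) (idx 2)) (X2 (idx 0) (idx 2))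
      (X2 (idx 0) (idx 1)) (X3 (idx 0) (idx 1) (idx 2))).smulc
      (fun _ => iteratedFDeriv ℝ 3 R θ (fun r => Pi.single (idx r) 1)) continuous_const)
  have P4 := AuxML.sum (μ := μ) (fun idx : Fin 4 → Fin m =>
    (aux_lim4 (x := fun r n ω => X n ω (idx r)) (fun r => l (idx r))
      (fun r => l (idx r) * θ (idx r))
      (fun r => X1 (idx r)) (fun r s => X2 (idx r) (idx s))
      (fun r s t => X3 (idx r) (idx s) (idx t)) (X4 _ _ _ _)).smulc
      (fun _ => iteratedFDeriv ℝ 4 R θ (fun r => Pi.single (idx r) 1)) continuous_const)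
  have Q2 : AuxML μ (fun n ω => iteratedFDeriv ℝ 2 R θ (fun _ => Y n ω)
      - iteratedFDeriv ℝ 2 R θ (fun _ => X n ω))
      (∑ i, ∑ j, H i j * ((l i + l j) * Sig i j + l i * θ i * (l j * θ j))) := by
    refine P2.congr (fun n ω => ?_) ?_
    · rw [aux_diag_expand, aux_diag_expand, ← Finset.sum_sub_distrib]
      refine Finset.sum_congr rfl fun idx _ => ?_
      simp only [Fin.prod_univ_two, hY]; ring
    · rw [← aux_sum2]
      refine Finset.sum_congr rfl fun idx _ => ?_
      rw [hH]
      congr 2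
      funext r; fin_cases r <;> rfl
  have Q3 : AuxML μ (fun n ω => iteratedFDeriv ℝ 3 R θ (fun _ => Y n ω)
      - iteratedFDeriv ℝ 3 R θ (fun _ => X n ω))
      (∑ i, ∑ j, ∑ k, T i j k * (l i * θ i * Sig j k + l j * θ j * Sig i k
        + l k * θ k * Sig i j)) := by
    refine P3.congr (fun n ω => ?_) ?_
    · rw [aux_diag_expand, aux_diag_expand, ← Finset.sum_sub_distrib]
      refine Finset.sum_congr rfl fun idx _ => ?_
      simp only [Fin.prod_univ_three, hY]; ring
    · rw [← aux_sum3]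
      refine Finset.sum_congr rfl fun idx _ => ?_
      rw [hT]
      congr 2
      funext r; fin_cases r <;> rfl
  have Q4 : AuxML μ (fun n ω => iteratedFDeriv ℝ 4 R θ (fun _ => Y n ω)
      - iteratedFDeriv ℝ 4 R θ (fun _ => X n ω)) 0 := by
    refine P4.congr (fun n ω => ?_) (by simp)
    rw [aux_diag_expand, aux_diag_expand, ← Finset.sum_sub_distrib]
    refine Finset.sum_congr rfl fun idx _ => ?_
    simp only [Fin.prod_univ_four, hY]; ring
  have QQ := ((Q2.smulc (fun _ => 1/2) continuous_const).add
    (Q3.smulc (fun _ => 1/6) continuous_const)).add (Q4.smulc (fun _ => 1/24) continuous_const)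
  have hDint : ∀ n, Integrable (fun ω => R (θ + Y n ω) - R (θ + X n ω)) μ := fun n => by
    have := (hRint n l).sub (hRint0 n)
    refine this.congr (ae_of_all _ fun ω => ?_)
    simp only [Pi.sub_apply, eY, eX n ω]
  -- remainder
  have hK0 : 0 ≤ K := (abs_nonneg _).trans (hK θ (fun _ => ⟨0, hm⟩))
  have B5 : ∀ l' : Fin m → ℝ, AuxML μ (fun n ω => ∑ i, (((1 + |l' i| + |l' i * θ i|) ^ 5 * 16) *
      (√(n:ℝ) * X n ω i ^ 6 + (√(n:ℝ))⁻¹ * X n ω i ^ 4 + (n:ℝ)⁻¹ ^ 5))) 0 := by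
    intro l'
    refine (AuxML.sum (μ := μ) (fun i => (((X6 i).add (X4' i)).add
      ((aux_M0 (μ := μ)).smulc (fun e => e ^ 3) (by fun_prop))).smulc
        (fun _ => (1 + |l' i| + |l' i * θ i|) ^ 5 * 16) continuous_const)).congr
      (fun n ω => ?_) (by simp)
    refine Finset.sum_congr rfl fun i _ => ?_
    ring
  have hb5 : ∀ᶠ n : ℕ in atTop, ∀ ω, ∀ l' : Fin m → ℝ,
      ‖(fun i => (1 + (n:ℝ)⁻¹ * l' i) * X n ω i + (n:ℝ)⁻¹ * (l' i * θ i))‖ ^ 5 ≤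
      ∑ i, (((1 + |l' i| + |l' i * θ i|) ^ 5 * 16) *
      (√(n:ℝ) * X n ω i ^ 6 + (√(n:ℝ))⁻¹ * X n ω i ^ 4 + (n:ℝ)⁻¹ ^ 5)) := by
    filter_upwards [npos] with n hn ω l'
    refine (aux_norm_pow _).trans (Finset.sum_le_sum fun i _ => ?_)
    exact aux_five _ _ _ _ _ (by positivity) (Nat.cast_inv_le_one n) (Real.sqrt_pos.2 hn)
  have Rem : AuxML μ (fun n ω => (R (θ + Y n ω) - R (θ + X n ω)) -
      (1/2 * (iteratedFDeriv ℝ 2 R θ (fun _ => Y n ω) - iteratedFDeriv ℝ 2 R θ (fun _ => X n ω))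
      + 1/6 * (iteratedFDeriv ℝ 3 R θ (fun _ => Y n ω) - iteratedFDeriv ℝ 3 R θ (fun _ => X n ω))
      + 1/24 * (iteratedFDeriv ℝ 4 R θ (fun _ => Y n ω)
        - iteratedFDeriv ℝ 4 R θ (fun _ => X n ω)))) 0 := by
    have hg := ((B5 l).add (B5 0)).smulc (fun _ => (m:ℝ)^5 * K) continuous_const
    rw [add_zero, mul_zero] at hg
    refine hg.of_le (fun n => (hDint n).sub (QQ.1 n)) ?_
    filter_upwards [hb5] with n hn ω
    have t1 := aux_taylor θ R hR hC1 K hK (Y n ω)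
    have t2 := aux_taylor θ R hR hC1 K hK (X n ω)
    have n1 := hn ω l
    have n2 := hn ω 0
    have e0 : (fun i => (1 + (n:ℝ)⁻¹ * (0 : Fin m → ℝ) i) * X n ω i
        + (n:ℝ)⁻¹ * ((0 : Fin m → ℝ) i * θ i)) = X n ω := by
      funext i; simp
    rw [e0] at n2
    change ‖Y n ω‖ ^ 5 ≤ _ at n1
    have hC : 0 ≤ (m:ℝ)^5 * K := by positivity
    have m1 := mul_le_mul_of_nonneg_left n1 hC
    have m2 := mul_le_mul_of_nonneg_left n2 hC
    rw [mul_add]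
    refine le_trans ?_ (add_le_add m1 m2)
    rw [abs_le] at t1 t2 ⊢
    constructor <;> linarith [t1.1, t1.2, t2.1, t2.2]
  have hFin := (Rem.add QQ).2
  have lim : 0 + (1/2 * (∑ i, ∑ j, H i j * ((l i + l j) * Sig i j + l i * θ i * (l j * θ j)))
      + 1/6 * (∑ i, ∑ j, ∑ k, T i j k * (l i * θ i * Sig j k + l j * θ j * Sig i k
        + l k * θ k * Sig i j)) + 1/24 * 0) = q l := by
    have s2 : ∑ i, ∑ j, H i j * ((l i + l j) * Sig i j + l i * θ i * (l j * θ j))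
        = 2 * ∑ i, ∑ j, H i j * l i * Sig i j + ∑ i, ∑ j, l i * A i j * l j := by
      have : ∑ i, ∑ j, H i j * l j * Sig i j = ∑ i, ∑ j, H i j * l i * Sig i j := by
        rw [Finset.sum_comm]
        refine Finset.sum_congr rfl fun i _ => Finset.sum_congr rfl fun j _ => ?_
        rw [hHs, hSs]
      rw [two_mul]
      conv_rhs => enter [1, 2]; rw [← this]
      simp_rw [← Finset.sum_add_distrib]
      refine Finset.sum_congr rfl fun i _ => Finset.sum_congr rfl fun j _ => ?_
      rw [hA]; ring
    have s3 : ∑ i, ∑ j, ∑ k, T i j k * (l i * θ i * Sig j k + l j * θ j * Sig i k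
        + l k * θ k * Sig i j) = 3 * ∑ i, ∑ j, H i j * (l i * M i j) := by
      rw [hC2]
      have a1 : ∑ i, ∑ j, ∑ k, T i j k * (l j * θ j) * Sig i k
          = ∑ i, ∑ j, ∑ k, T i j k * (l i * θ i) * Sig j k := by
        rw [Finset.sum_comm]
        refine Finset.sum_congr rfl fun i _ => Finset.sum_congr rfl fun j _ =>
          Finset.sum_congr rfl fun k _ => ?_
        rw [hTb]
      have a2 : ∑ i, ∑ j, ∑ k, T i j k * (l k * θ k) * Sig i j
          = ∑ i, ∑ j, ∑ k, T i j k * (l j * θ j) * Sig i k := by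
        refine Finset.sum_congr rfl fun i _ => ?_
        rw [Finset.sum_comm]
        refine Finset.sum_congr rfl fun j _ => Finset.sum_congr rfl fun k _ => ?_
        rw [hTa]
      have a3 : ∑ i, ∑ j, ∑ k, T i j k * (l i * θ i * Sig j k + l j * θ j * Sig i k
          + l k * θ k * Sig i j) = ∑ i, ∑ j, ∑ k, T i j k * (l i * θ i) * Sig j k
          + ∑ i, ∑ j, ∑ k, T i j k * (l j * θ j) * Sig i k
          + ∑ i, ∑ j, ∑ k, T i j k * (l k * θ k) * Sig i j := by
        simp_rw [← Finset.sum_add_distrib]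
        refine Finset.sum_congr rfl fun i _ => Finset.sum_congr rfl fun j _ =>
          Finset.sum_congr rfl fun k _ => ?_
        ring
      rw [a3, a2, a1]; ring
    have s4 : ∑ i, b i * l i = 2 * ∑ i, ∑ j, H i j * l i * Sig i j
        + ∑ i, ∑ j, H i j * (l i * M i j) := by
      simp_rw [hb, Finset.mul_sum, Finset.sum_mul, ← Finset.sum_add_distrib]
      refine Finset.sum_congr rfl fun i _ => Finset.sum_congr rfl fun j _ => ?_
      ring
    rw [hq, s2, s3, s4]; ring
  rw [lim] at hFin
  refine hFin.congr fun n => ?_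
  congr 1
  rw [← integral_sub (hRint n l) (hRint0 n)]
  congr 1
  funext ω
  rw [eY, eX n ω]
  ring
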